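/- arXiv:1211.2473 — 2 statements merged into one kernel-verified Lean document; each statement's English description precedes it below -/
import Mathlib

section
/- Let U : [0,1]² → [0,1] be Lebesgue measurable and suppose the kernel axioms hold almost everywhere with respect to Lebesgue measure: for a.e. (x,y), U(x,y) > 0 implies x < y, and for a.e. (x,y,z), U(x,y) > 0 and U(y,z) > 0 imply U(x,z) = 1. Then there is a Borel function U' : [0,1]² → [0,1] equal to U almost everywhere such that the axioms hold for all points: for all x,y,z ∈ [0,1], U'(x,y) > 0 ⟹ x < y, and U'(x,y) > 0 ∧ U'(y,z) > 0 ⟹ U'(x,z) = 1. -/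
open MeasureTheory

/-- The unit interval `[0,1]` as a measure space (with Lebesgue measure). -/
local notation "I" => (Set.Icc (0:ℝ) 1)

noncomputable def rho6 (S : Set (I × I)) (n : ℕ) (p : I × I) : ℝ :=
  ((volume.prod volume : Measure (I × I)) (S ∩ Metric.closedBall p (1 / ((n:ℝ) + 1)))).toReal /
  ((volume.prod volume : Measure (I × I)) (Metric.closedBall p (1 / ((n:ℝ) + 1)))).toReal

def D6 (S : Set (I × I)) : Set (I × I) :=
  {p | Filter.Tendsto (fun n => rho6 S n p) Filter.atTop (nhds 1)}

theorem meas_aux6 (S : Set (I × I)) (hS : MeasurableSet S) (r : ℝ) :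
    Measurable (fun p : I × I => (volume.prod volume : Measure (I × I)) (S ∩ Metric.closedBall p r)) := by
  have h : MeasurableSet {x : (I × I) × (I × I) | x.2 ∈ S ∧ dist x.2 x.1 ≤ r} :=
    (measurable_snd hS).inter
      (measurableSet_le (measurable_snd.dist measurable_fst) measurable_const)
  exact measurable_measure_prodMk_left (ν := (volume.prod volume : Measure (I × I))) h

theorem measD6 (S : Set (I × I)) (hS : MeasurableSet S) : MeasurableSet (D6 S) := by
  refine measurableSet_tendsto (nhds (1:ℝ)) (fun n => ?_)
  refine (meas_aux6 S hS _).ennreal_toReal.div ?_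
  have := meas_aux6 Set.univ MeasurableSet.univ (1 / ((n:ℝ) + 1))
  simp only [Set.univ_inter] at this
  exact this.ennreal_toReal

theorem emb6 : MeasurableEmbedding (Prod.map Subtype.val Subtype.val : I × I → ℝ × ℝ) := 
  (MeasurableEmbedding.subtype_coe measurableSet_Icc).prodMap
    (MeasurableEmbedding.subtype_coe measurableSet_Icc)

theorem density6 (S : Set (I × I)) (hS : MeasurableSet S) :
    ∀ᵐ p : I × I ∂(volume.prod volume), p ∈ D6 S ↔ p ∈ S := by
  set m : Measure (I × I) := volume.prod volume with hm
  set φ : I × I → ℝ × ℝ := Prod.map Subtype.val Subtype.val with hφ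
  have hinj : Function.Injective φ := emb6.injective
  have hT : MeasurableSet (φ '' S) := emb6.measurableSet_image.2 hS
  have h := Besicovitch.ae_tendsto_measure_inter_div_of_measurableSet (m.map φ) hT
  have h2 := ae_of_ae_map emb6.measurable.aemeasurable h
  filter_upwards [h2] with p hp
  have hball : ∀ r, φ ⁻¹' (Metric.closedBall (φ p) r) = Metric.closedBall p r := by
    intro r; ext q; rfl
  have hseq : Filter.Tendsto (fun n : ℕ => 1 / ((n:ℝ) + 1)) Filter.atTop (nhdsWithin 0 (Set.Ioi 0)) := by
    refine tendsto_nhdsWithin_iff.2 ⟨tendsto_one_div_add_atTop_nhds_zero_nat, ?_⟩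
    exact Filter.Eventually.of_forall fun n => by simp only [Set.mem_Ioi]; positivity
  have h3 := hp.comp hseq
  have hind : (φ '' S).indicator (1 : ℝ × ℝ → ENNReal) (φ p) = S.indicator 1 p := by
    by_cases hpS : p ∈ S
    · rw [Set.indicator_of_mem hpS, Set.indicator_of_mem (Set.mem_image_of_mem _ hpS)]; rfl
    · rw [Set.indicator_of_notMem hpS, Set.indicator_of_notMem]
      rwa [hinj.mem_set_image]
  rw [hind] at h3
  have hfin : S.indicator (1 : I × I → ENNReal) p ≠ ⊤ := by
    by_cases hpS : p ∈ S <;> simp [hpS]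
  have h4 := (ENNReal.tendsto_toReal hfin).comp h3
  have h5 : Filter.Tendsto (fun n => rho6 S n p) Filter.atTop
      (nhds (S.indicator (1 : I × I → ENNReal) p).toReal) := by
    refine h4.congr fun n => ?_
    simp only [Function.comp, rho6]
    rw [emb6.map_apply, emb6.map_apply, Set.preimage_inter, hball, hinj.preimage_image,
      ENNReal.toReal_div]
  constructor
  · intro hD
    by_contra hpS
    have := tendsto_nhds_unique hD h5
    simp [hpS] at this
  · intro hpS
    simpa [D6, hpS] using h5

noncomputable abbrev m26 : Measure (I × I) := volume.prod volume
noncomputable abbrev m36 : Measure (I × I × I) := volume.prod (volume.prod volume)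

theorem mp12 : MeasurePreserving (fun t : I × I × I => ((t.1, t.2.1), t.2.2)) m36 (m26.prod volume) :=
  (measurePreserving_prodAssoc (volume : Measure I) (volume : Measure I) (volume : Measure I)).symm

theorem mp13 : MeasurePreserving (fun t : I × I × I => (t.2.1, (t.1, t.2.2))) m36
    ((volume : Measure I).prod m26) := by
  have h1 : MeasurePreserving (Prod.map Prod.swap id : (I × I) × I → (I × I) × I)
      (m26.prod volume) (m26.prod volume) :=
    Measure.measurePreserving_swap.prod (MeasurePreserving.id _)
  exact (measurePreserving_prodAssoc (volume : Measure I) (volume : Measure I) (volume : Measure I)).comp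
    (h1.comp mp12)

theorem ineq6 (P Q : Set (I × I)) (hP : MeasurableSet P) (hQ : MeasurableSet Q)
    (h : ∀ᵐ t ∂m36, (t.1, t.2.1) ∈ P → t.2 ∈ P → (t.1, t.2.2) ∈ Q)
    (A B C : Set I) (hA : MeasurableSet A) (hB : MeasurableSet B) (hC : MeasurableSet C) :
    (volume.real A) * volume.real B * volume.real C ≤
      m26.real (A ×ˢ B \ P) * volume.real C + m26.real (B ×ˢ C \ P) * volume.real A
      + m26.real (Q ∩ A ×ˢ C) * volume.real B := by
  have e1 : m36.real ((fun t : I × I × I => ((t.1, t.2.1), t.2.2)) ⁻¹' ((A ×ˢ B \ P) ×ˢ C))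
      = m26.real (A ×ˢ B \ P) * volume.real C := by
    rw [measureReal_def, mp12.measure_preimage (by measurability), ← measureReal_def, measureReal_prod_prod]
  have e2 : m36.real (A ×ˢ (B ×ˢ C \ P)) = m26.real (B ×ˢ C \ P) * volume.real A := by
    rw [measureReal_prod_prod, mul_comm]
  have e3 : m36.real ((fun t : I × I × I => (t.2.1, (t.1, t.2.2))) ⁻¹' (B ×ˢ (Q ∩ A ×ˢ C)))
      = m26.real (Q ∩ A ×ˢ C) * volume.real B := by
    rw [measureReal_def, mp13.measure_preimage (by measurability), ← measureReal_def, measureReal_prod_prod,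
      mul_comm]
  have e0 : m36.real (A ×ˢ B ×ˢ C) = volume.real A * volume.real B * volume.real C := by
    rw [measureReal_prod_prod, measureReal_prod_prod, mul_assoc]
  rw [← e0, ← e1, ← e2, ← e3]
  refine le_trans ?_ ((measureReal_union_le _ _).trans
    (add_le_add_left (measureReal_union_le _ _) _))
  refine ENNReal.toReal_mono (measure_ne_top _ _) (measure_mono_ae ?_)
  filter_upwards [h] with t ht hm
  obtain ⟨hA, hB, hC⟩ := hm
  by_cases h1 : (t.1, t.2.1) ∈ P
  · by_cases h2 : t.2 ∈ P
    · right; exact ⟨hB, ht h1 h2, hA, hC⟩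
    · left; right; exact ⟨hA, ⟨hB, hC⟩, h2⟩
  · left; left; exact ⟨⟨⟨hA, hB⟩, h1⟩, hC⟩

theorem comp6 (P Q : Set (I × I)) (hP : MeasurableSet P) (hQ : MeasurableSet Q)
    (h : ∀ᵐ t ∂m36, (t.1, t.2.1) ∈ P → t.2 ∈ P → (t.1, t.2.2) ∈ Q)
    (x y z : I) (hxy : (x, y) ∈ D6 P) (hyz : (y, z) ∈ D6 P) : (x, z) ∈ D6 Q := by
  have hxy' : Filter.Tendsto (fun n => rho6 P n (x, y)) Filter.atTop (nhds 1) := hxy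
  have hyz' : Filter.Tendsto (fun n => rho6 P n (y, z)) Filter.atTop (nhds 1) := hyz
  have hlow : Filter.Tendsto (fun n => rho6 P n (x, y) + rho6 P n (y, z) - 1) Filter.atTop (nhds 1) := by
    have := (hxy'.add hyz').sub_const 1
    norm_num at this
    exact this
  have key : ∀ S : Set (I × I), ∀ n a b, rho6 S n (a, b) =
      m26.real (S ∩ Metric.closedBall a (1 / ((n:ℝ) + 1)) ×ˢ Metric.closedBall b (1 / ((n:ℝ) + 1))) /
      (volume.real (Metric.closedBall a (1 / ((n:ℝ) + 1))) *
        volume.real (Metric.closedBall b (1 / ((n:ℝ) + 1)))) := by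
    intro S n a b
    rw [← measureReal_prod_prod, rho6, closedBall_prod_same]; rfl
  refine tendsto_of_tendsto_of_tendsto_of_le_of_le' hlow tendsto_const_nhds ?_ ?_
  · filter_upwards [hxy'.eventually (lt_mem_nhds (zero_lt_one)),
      hyz'.eventually (lt_mem_nhds (zero_lt_one))] with n h1 h2
    rw [key] at h1 h2 ⊢
    rw [key, key]
    have hi := ineq6 P Q hP hQ h (Metric.closedBall x (1 / ((n:ℝ) + 1)))
      (Metric.closedBall y (1 / ((n:ℝ) + 1))) (Metric.closedBall z (1 / ((n:ℝ) + 1)))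
      Metric.isClosed_closedBall.measurableSet Metric.isClosed_closedBall.measurableSet
      Metric.isClosed_closedBall.measurableSet
    generalize Metric.closedBall x (1 / ((n:ℝ) + 1)) = A at *
    generalize Metric.closedBall y (1 / ((n:ℝ) + 1)) = B at *
    generalize Metric.closedBall z (1 / ((n:ℝ) + 1)) = C at *
    have s1 := measureReal_inter_add_sdiff (μ := m26) (s := A ×ˢ B) hP
    have s2 := measureReal_inter_add_sdiff (μ := m26) (s := B ×ˢ C) hP
    rw [measureReal_prod_prod, Set.inter_comm] at s1 s2
    have d1 : volume.real A * volume.real B ≠ 0 := by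
      intro h0; rw [h0, div_zero] at h1; exact lt_irrefl _ h1
    have d2 : volume.real B * volume.real C ≠ 0 := by
      intro h0; rw [h0, div_zero] at h2; exact lt_irrefl _ h2
    have a0 : 0 < volume.real A := lt_of_le_of_ne measureReal_nonneg (Ne.symm (left_ne_zero_of_mul d1))
    have b0 : 0 < volume.real B := lt_of_le_of_ne measureReal_nonneg (Ne.symm (left_ne_zero_of_mul d2))
    have c0 : 0 < volume.real C := lt_of_le_of_ne measureReal_nonneg (Ne.symm (right_ne_zero_of_mul d2))
    rw [← eq_sub_iff_add_eq'] at s1 s2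
    rw [s1, s2] at hi
    generalize volume.real A = a at *
    generalize volume.real B = b at *
    generalize volume.real C = c at *
    generalize m26.real (P ∩ A ×ˢ B) = p at *
    generalize m26.real (P ∩ B ×ˢ C) = q at *
    generalize m26.real (Q ∩ A ×ˢ C) = w at *
    have e : w / (a * c) - (p / (a * b) + q / (b * c) - 1) =
      (w * b - p * c - q * a + a * b * c) / (a * b * c) := by field_simp; ring
    have : 0 ≤ (w * b - p * c - q * a + a * b * c) / (a * b * c) :=
      div_nonneg (by nlinarith) (by positivity)
    linarith
  · refine Filter.Eventually.of_forall fun n => ?_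
    exact div_le_one_of_le₀ (ENNReal.toReal_mono (measure_ne_top _ _)
      (measure_mono Set.inter_subset_right)) ENNReal.toReal_nonneg

theorem stmt6 (U : I → I → ℝ) (hUrange : ∀ x y, U x y ∈ Set.Icc (0:ℝ) 1)
    (hUmeas : AEMeasurable (fun p : I × I => U p.1 p.2) (volume.prod volume))
    (hax1 : ∀ᵐ p : I × I ∂(volume.prod volume), 0 < U p.1 p.2 → p.1 < p.2)
    (hax2 : ∀ᵐ t : I × I × I ∂(volume.prod (volume.prod volume)),
      0 < U t.1 t.2.1 → 0 < U t.2.1 t.2.2 → U t.1 t.2.2 = 1) :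
    ∃ U' : I → I → ℝ,
      Measurable (fun p : I × I => U' p.1 p.2) ∧
      (∀ x y, U' x y ∈ Set.Icc (0:ℝ) 1) ∧
      (∀ᵐ p : I × I ∂(volume.prod volume), U' p.1 p.2 = U p.1 p.2) ∧
      (∀ x y, 0 < U' x y → x < y) ∧
      (∀ x y z, 0 < U' x y → 0 < U' y z → U' x z = 1) := by
  classical
  obtain ⟨V, hV, hUV⟩ := hUmeas
  set P : Set (I × I) := {p | 0 < V p} with hPdef
  set Q : Set (I × I) := {p | V p = 1} with hQdef
  have hP : MeasurableSet P := measurableSet_lt measurable_const hV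
  have hQ : MeasurableSet Q := hV (measurableSet_singleton 1)
  have h : ∀ᵐ t ∂m36, (t.1, t.2.1) ∈ P → t.2 ∈ P → (t.1, t.2.2) ∈ Q := by
    have q12 : ∀ᵐ t ∂m36, U t.1 t.2.1 = V (t.1, t.2.1) :=
      (Measure.quasiMeasurePreserving_fst.comp mp12.quasiMeasurePreserving).ae hUV
    have q23 : ∀ᵐ t ∂m36, U t.2.1 t.2.2 = V t.2 :=
      (Measure.quasiMeasurePreserving_snd (μ := (volume : Measure I)) (ν := m26)).ae hUV
    have q13 : ∀ᵐ t ∂m36, U t.1 t.2.2 = V (t.1, t.2.2) :=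
      (Measure.quasiMeasurePreserving_snd.comp mp13.quasiMeasurePreserving).ae hUV
    filter_upwards [q12, q23, q13, hax2] with t h1 h2 h3 h4 h5 h6
    simp only [hPdef, hQdef, Set.mem_ofPred_eq] at *
    rw [← h3]
    exact h4 (h1 ▸ h5) (h2 ▸ h6)
  have hQP : D6 Q ⊆ D6 P := by
    intro p hp
    have hp' : Filter.Tendsto (fun n => rho6 Q n p) Filter.atTop (nhds 1) := hp
    refine tendsto_of_tendsto_of_tendsto_of_le_of_le hp' tendsto_const_nhds ?_ ?_
    · intro n
      refine div_le_div_of_nonneg_right (ENNReal.toReal_mono (measure_ne_top _ _)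
        (measure_mono (Set.inter_subset_inter_left _ ?_))) ENNReal.toReal_nonneg
      intro q hq
      simp only [hPdef, hQdef, Set.mem_ofPred_eq] at *
      rw [hq]; exact one_pos
    · intro n
      exact div_le_one_of_le₀ (ENNReal.toReal_mono (measure_ne_top _ _)
        (measure_mono Set.inter_subset_right)) ENNReal.toReal_nonneg
  let W : I × I → ℝ := fun p => if p.1 < p.2 then
    (if p ∈ D6 Q then 1 else if p ∈ D6 P then max 0 (min 1 (V p)) else 0) else 0
  have hpos : ∀ p, 0 < W p → p.1 < p.2 ∧ p ∈ D6 P := by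
    intro p hp
    simp only [W] at hp
    split_ifs at hp with h1 h2 h3
    · exact ⟨h1, hQP h2⟩
    · exact ⟨h1, h3⟩
    · exact absurd hp (lt_irrefl _)
    · exact absurd hp (lt_irrefl _)
  refine ⟨fun x y => W (x, y), ?_, ?_, ?_, ?_, ?_⟩
  · refine Measurable.ite (measurableSet_lt measurable_fst measurable_snd) ?_ measurable_const
    refine Measurable.ite (measD6 Q hQ) measurable_const ?_
    exact Measurable.ite (measD6 P hP) (measurable_const.max (measurable_const.min hV)) measurable_const
  · intro x y
    simp only [W]
    split_ifs <;> simp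
  · filter_upwards [hUV, hax1, density6 P hP, density6 Q hQ] with p h1 h2 h3 h4
    have hr := hUrange p.1 p.2
    simp only [W, h3, h4]
    simp only [hPdef, hQdef, Set.mem_ofPred_eq]
    rw [← h1]
    have hr0 := hr.1
    have hr1 := hr.2
    split_ifs with g1 g2 g3
    · exact g2.symm
    · rw [min_eq_right hr1, max_eq_right hr0]
    · linarith
    · by_contra hne
      exact g1 (h2 (lt_of_le_of_ne hr0 hne))
  · intro x y hxy
    exact (hpos _ hxy).1
  · intro x y z hxy hyz
    have a := hpos _ hxy
    have b := hpos _ hyz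
    have hlt : x < z := lt_trans a.1 b.1
    have hD := comp6 P Q hP hQ h x y z a.2 b.2
    simp [W, hlt, hD]
end

section
/- Regularity Lemma for Posets: for every ε > 0 there exists M such that every finite poset (P, ≺) equipped with a poset partition P into at most 1/ε parts admits a poset refinement R of P which is ε-regular and has at most M parts. -/
open scoped Classical

/-- Number of related pairs from `A` to `B`. -/
noncomputable def eRel {α : Type} [PartialOrder α] (A B : Finset α) : ℕ :=
  ((A ×ˢ B).filter fun p => p.1 < p.2).card

/-- Density of the pair `(A, B)` (zero if `A` or `B` is empty). -/
noncomputable def dens {α : Type} [PartialOrder α] (A B : Finset α) : ℝ :=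
  (eRel A B : ℝ) / ((A.card : ℝ) * (B.card : ℝ))

/-- The pair `(A,B)` is `ε`-regular. -/
def IsRegularPair {α : Type} [PartialOrder α] (ε : ℝ) (A B : Finset α) : Prop :=
  ∀ X ⊆ A, ∀ Y ⊆ B, ε * (A.card : ℝ) ≤ (X.card : ℝ) → ε * (B.card : ℝ) ≤ (Y.card : ℝ) →
    |dens A B - dens X Y| < ε

/-- An ordered partition `(V 0, …, V (k-1))` of the ground set is a poset partition if the
parts are pairwise disjoint, cover everything, and all cross-relations go forward. -/
def IsPosetPartition {α : Type} [Fintype α] [PartialOrder α] {k : ℕ}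
    (V : Fin k → Finset α) : Prop :=
  (∀ i j, i ≠ j → Disjoint (V i) (V j)) ∧
  (Finset.univ.biUnion V = (Finset.univ : Finset α)) ∧
  (∀ i j : Fin k, j < i → ∀ x ∈ V i, ∀ y ∈ V j, ¬ x < y)

/-- A partition is `ε`-regular: all parts have size at most `max (ε|P|) 1` and the
total weight `|V i||V j|` of irregular pairs `i < j` is at most `ε·C(|P|,2)`. -/
noncomputable def IsRegularPartition {α : Type} [Fintype α] [PartialOrder α] (ε : ℝ)
    {k : ℕ} (V : Fin k → Finset α) : Prop :=
  (∀ i, ((V i).card : ℝ) ≤ max (ε * (Fintype.card α : ℝ)) 1) ∧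
  (∑ p ∈ Finset.univ.filter
      (fun p : Fin k × Fin k => p.1 < p.2 ∧ ¬ IsRegularPair ε (V p.1) (V p.2)),
      ((V p.1).card : ℝ) * ((V p.2).card : ℝ)) ≤
    ε * (((Fintype.card α).choose 2 : ℕ) : ℝ)

namespace PR

noncomputable def ind {α : Type} [PartialOrder α] (x y : α) : ℝ := if x < y then 1 else 0

noncomputable def cls {α γ : Type} [Fintype α] (p : α → γ) (x : α) : Finset α :=
  Finset.univ.filter fun y => p y = p x

noncomputable def dp {α γ : Type} [Fintype α] [PartialOrder α] (p : α → γ) (z : α × α) : ℝ :=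
  dens (cls p z.1) (cls p z.2)

noncomputable def irr {α γ : Type} [Fintype α] [PartialOrder α] (ε : ℝ) (p : α → γ) :
    Finset (α × α) :=
  Finset.univ.filter fun z => ¬ IsRegularPair ε (cls p z.1) (cls p z.2)

noncomputable def nimg {α γ : Type} [Fintype α] (p : α → γ) : ℕ := (Finset.univ.image p).card

lemma eRel_eq {α : Type} [PartialOrder α] (A B : Finset α) :
    (eRel A B : ℝ) = ∑ z ∈ A ×ˢ B, ind z.1 z.2 := by
  simp [eRel, ind]

lemma mem_cls {α γ : Type} [Fintype α] (p : α → γ) (x y : α) : y ∈ cls p x ↔ p y = p x := by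
  simp [cls]

lemma self_cls {α γ : Type} [Fintype α] (p : α → γ) (x : α) : x ∈ cls p x := by
  simp [cls]

lemma cls_pos {α γ : Type} [Fintype α] (p : α → γ) (x : α) : (0:ℝ) < (cls p x).card := by
  exact_mod_cast Finset.card_pos.2 ⟨x, self_cls p x⟩

lemma cls_congr {α γ : Type} [Fintype α] (p : α → γ) {x y : α} (h : p x = p y) :
    cls p x = cls p y := by
  simp [cls, h]

lemma dp_congr {α γ : Type} [Fintype α] [PartialOrder α] (p : α → γ) {z w : α × α}
    (h1 : p z.1 = p w.1) (h2 : p z.2 = p w.2) : dp p z = dp p w := by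
  simp [dp, cls_congr p h1, cls_congr p h2]

lemma dens_nonneg {α : Type} [PartialOrder α] (A B : Finset α) : 0 ≤ dens A B := by
  unfold dens; positivity

lemma dens_le_one {α : Type} [PartialOrder α] (A B : Finset α) : dens A B ≤ 1 := by
  unfold dens
  apply div_le_one_of_le₀ _ (by positivity)
  have : eRel A B ≤ (A ×ˢ B).card := Finset.card_filter_le _ _
  rw [Finset.card_product] at this
  exact_mod_cast this

lemma ind_sub_abs {α : Type} [PartialOrder α] (A B : Finset α) (x y : α) :
    |ind x y - dens A B| ≤ 1 := by
  have h0 := dens_nonneg A B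
  have h1 := dens_le_one A B
  unfold ind
  rw [abs_le]
  split_ifs <;> constructor <;> linarith

/-- averaging over cells -/
lemma avg {α γ : Type} [Fintype α] (p : α → γ) (F : α × α → ℝ) :
    ∑ z, F z = ∑ z : α × α, (∑ w ∈ cls p z.1 ×ˢ cls p z.2, F w) /
      (((cls p z.1).card : ℝ) * ((cls p z.2).card : ℝ)) := by
  have h : ∀ z : α × α, (∑ w ∈ cls p z.1 ×ˢ cls p z.2, F w) /
      (((cls p z.1).card : ℝ) * ((cls p z.2).card : ℝ)) =
      ∑ w : α × α, if w ∈ cls p z.1 ×ˢ cls p z.2 then F w /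
      (((cls p w.1).card : ℝ) * ((cls p w.2).card : ℝ)) else 0 := by
    intro z
    rw [Finset.sum_div, ← Finset.sum_filter]
    have : Finset.univ.filter (fun w => w ∈ cls p z.1 ×ˢ cls p z.2) = cls p z.1 ×ˢ cls p z.2 := by
      ext; simp
    rw [this]
    apply Finset.sum_congr rfl
    intro w hw
    rw [Finset.mem_product, mem_cls, mem_cls] at hw
    rw [cls_congr p hw.1, cls_congr p hw.2]
  simp_rw [h]
  rw [Finset.sum_comm]
  apply Finset.sum_congr rfl
  intro w _
  have h2 : ∀ z : α × α, w ∈ cls p z.1 ×ˢ cls p z.2 ↔ z ∈ cls p w.1 ×ˢ cls p w.2 := by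
    intro z
    simp only [Finset.mem_product, mem_cls, eq_comm]
  simp_rw [h2]
  rw [← Finset.sum_filter]
  have : Finset.univ.filter (fun z => z ∈ cls p w.1 ×ˢ cls p w.2) = cls p w.1 ×ˢ cls p w.2 := by
    ext; simp
  rw [this, Finset.sum_const, Finset.card_product, nsmul_eq_mul]
  have := cls_pos p w.1
  have := cls_pos p w.2
  push_cast
  field_simp

/-- projection property -/
lemma proj {α γ : Type} [Fintype α] [PartialOrder α] (p : α → γ) (g : α × α → ℝ)
    (hg : ∀ z w : α × α, p z.1 = p w.1 → p z.2 = p w.2 → g z = g w) :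
    ∑ z : α × α, ind z.1 z.2 * g z = ∑ z, dp p z * g z := by
  rw [avg p (fun z => ind z.1 z.2 * g z)]
  apply Finset.sum_congr rfl
  intro z _
  have : ∑ w ∈ cls p z.1 ×ˢ cls p z.2, ind w.1 w.2 * g w =
      ∑ w ∈ cls p z.1 ×ˢ cls p z.2, ind w.1 w.2 * g z := by
    apply Finset.sum_congr rfl
    intro w hw
    rw [Finset.mem_product, mem_cls, mem_cls] at hw
    rw [hg w z hw.1 hw.2]
  rw [this, ← Finset.sum_mul, ← eRel_eq, dp, dens]
  ring

noncomputable def energy {α γ : Type} [Fintype α] [PartialOrder α] (p : α → γ) : ℝ :=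
  ∑ z, dp p z ^ 2

lemma energy_le {α γ : Type} [Fintype α] [PartialOrder α] (p : α → γ) :
    energy p ≤ (Fintype.card α : ℝ) ^ 2 := by
  have : energy p ≤ ∑ z : α × α, (1:ℝ) := by
    apply Finset.sum_le_sum
    intro z _
    have h0 := dens_nonneg (cls p z.1) (cls p z.2)
    have h1 := dens_le_one (cls p z.1) (cls p z.2)
    unfold dp
    nlinarith
  refine this.trans (le_of_eq ?_)
  simp [Fintype.card_prod, sq]

lemma energy_sub {α γ γ' : Type} [Fintype α] [PartialOrder α] (p : α → γ) (p' : α → γ')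
    (hr : ∀ x y, p' x = p' y → p x = p y) :
    energy p' - energy p = ∑ z, (dp p' z - dp p z) ^ 2 := by
  have h1 := proj p (dp p) (fun z w h h' => dp_congr p h h')
  have h2 := proj p' (dp p) (fun z w h h' => dp_congr p (hr _ _ h) (hr _ _ h'))
  have : ∑ z, (dp p' z - dp p z) ^ 2 =
      ∑ z, dp p' z ^ 2 - 2 * ∑ z, dp p' z * dp p z + ∑ z, dp p z * dp p z := by
    rw [Finset.mul_sum, ← Finset.sum_sub_distrib, ← Finset.sum_add_distrib]
    apply Finset.sum_congr rfl
    intro z _; ring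
  rw [this, ← h2, h1]
  simp only [energy, sq]
  ring

lemma c4 {α : Type} (A B X Y : Finset α) (hX : X ⊆ A) (hY : Y ⊆ B) (f : α → α → ℝ)
    : (∑ x ∈ X, ∑ y ∈ Y, f x y) ^ 4 ≤ (A.card : ℝ) ^ 2 * (B.card : ℝ) ^ 2 *
      ∑ x' ∈ A, ∑ y' ∈ B, f x' y' * ∑ x ∈ A, ∑ y ∈ B, f x y * (f x' y * f x y') := by
  have hXA : (X.card : ℝ) ≤ A.card := by exact_mod_cast Finset.card_le_card hX
  have hYB : (Y.card : ℝ) ≤ B.card := by exact_mod_cast Finset.card_le_card hY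
  have s1 : (∑ x ∈ X, ∑ y ∈ Y, f x y) ^ 2 ≤ A.card * ∑ x ∈ A, (∑ y ∈ Y, f x y) ^ 2 := by
    calc _ ≤ (X.card : ℝ) * ∑ x ∈ X, (∑ y ∈ Y, f x y) ^ 2 := sq_sum_le_card_mul_sum_sq
      _ ≤ _ := by
        apply mul_le_mul hXA _ (Finset.sum_nonneg fun _ _ => sq_nonneg _) (by positivity)
        exact Finset.sum_le_sum_of_subset_of_nonneg hX fun _ _ _ => sq_nonneg _
  have s2 : ∑ x ∈ A, (∑ y ∈ Y, f x y) ^ 2 = ∑ z ∈ Y ×ˢ Y, ∑ x ∈ A, f x z.1 * f x z.2 := by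
    rw [Finset.sum_comm]
    apply Finset.sum_congr rfl
    intro x _
    rw [sq, Finset.sum_mul_sum, Finset.sum_product]
  have s3 : (∑ z ∈ Y ×ˢ Y, ∑ x ∈ A, f x z.1 * f x z.2) ^ 2 ≤
      (B.card : ℝ) ^ 2 * ∑ z ∈ B ×ˢ B, (∑ x ∈ A, f x z.1 * f x z.2) ^ 2 := by
    calc _ ≤ ((Y ×ˢ Y).card : ℝ) * ∑ z ∈ Y ×ˢ Y, (∑ x ∈ A, f x z.1 * f x z.2) ^ 2 :=
          sq_sum_le_card_mul_sum_sq
      _ ≤ _ := by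
        apply mul_le_mul _ _ (Finset.sum_nonneg fun _ _ => sq_nonneg _) (by positivity)
        · rw [Finset.card_product]; push_cast; nlinarith
        · exact Finset.sum_le_sum_of_subset_of_nonneg (Finset.product_subset_product hY hY)
            fun _ _ _ => sq_nonneg _
  have s4 : ∑ z ∈ B ×ˢ B, (∑ x ∈ A, f x z.1 * f x z.2) ^ 2 =
      ∑ x' ∈ A, ∑ y' ∈ B, f x' y' * ∑ x ∈ A, ∑ y ∈ B, f x y * (f x' y * f x y') := by
    simp_rw [sq, Finset.sum_mul_sum, Finset.sum_product, Finset.mul_sum]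
    calc _ = ∑ y ∈ B, ∑ x' ∈ A, ∑ y' ∈ B, ∑ x ∈ A, f x y * f x y' * (f x' y * f x' y') := by
            apply Finset.sum_congr rfl
            intro y _
            symm
            rw [Finset.sum_comm]
            apply Finset.sum_congr rfl
            intro y' _
            rw [Finset.sum_comm]
      _ = ∑ x' ∈ A, ∑ y' ∈ B, ∑ x ∈ A, ∑ y ∈ B, f x y * f x y' * (f x' y * f x' y') := by
            rw [Finset.sum_comm]
            apply Finset.sum_congr rfl
            intro y _
            rw [Finset.sum_comm]
            apply Finset.sum_congr rfl
            intro y _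
            rw [Finset.sum_comm]
      _ = _ := by
            refine Finset.sum_congr rfl fun _ _ => Finset.sum_congr rfl fun _ _ =>
              Finset.sum_congr rfl fun _ _ => Finset.sum_congr rfl fun _ _ => ?_
            ring
  rw [← s4]
  rw [s2] at s1
  calc (∑ x ∈ X, ∑ y ∈ Y, f x y) ^ 4 = ((∑ x ∈ X, ∑ y ∈ Y, f x y) ^ 2) ^ 2 := by ring
    _ ≤ (A.card * ∑ z ∈ Y ×ˢ Y, ∑ x ∈ A, f x z.1 * f x z.2) ^ 2 :=
        pow_le_pow_left₀ (sq_nonneg _) s1 2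
    _ = (A.card : ℝ) ^ 2 * (∑ z ∈ Y ×ˢ Y, ∑ x ∈ A, f x z.1 * f x z.2) ^ 2 := by ring
    _ ≤ _ := by
      rw [mul_assoc]
      exact mul_le_mul_of_nonneg_left s3 (by positivity)

lemma witness {α : Type} [PartialOrder α] (ε : ℝ) (hε : 0 < ε) (A B : Finset α)
    (hA : A.Nonempty) (hB : B.Nonempty) (h : ¬ IsRegularPair ε A B) :
    ∃ w : α × α, ε ^ 12 * ((A.card : ℝ) * B.card) ≤
      |∑ z ∈ A ×ˢ B, (ind z.1 z.2 - dens A B) *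
        ((ind w.1 z.2 - dens A B) * (ind z.1 w.2 - dens A B))| := by
  unfold IsRegularPair at h
  push Not at h
  obtain ⟨X, hX, Y, hY, h1, h2, h3⟩ := h
  have hA' : (0:ℝ) < A.card := by exact_mod_cast hA.card_pos
  have hB' : (0:ℝ) < B.card := by exact_mod_cast hB.card_pos
  have hX' : (0:ℝ) < X.card := lt_of_lt_of_le (by positivity) h1
  have hY' : (0:ℝ) < Y.card := lt_of_lt_of_le (by positivity) h2
  set d := dens A B with hd
  set f : α → α → ℝ := fun x y => ind x y - d with hf
  have e1 : ∑ x ∈ X, ∑ y ∈ Y, f x y = (X.card * Y.card : ℝ) * (dens X Y - d) := by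
    rw [← Finset.sum_product' X Y f]
    simp only [hf]
    rw [Finset.sum_sub_distrib, ← eRel_eq, Finset.sum_const, Finset.card_product, nsmul_eq_mul]
    unfold dens
    push_cast
    field_simp
  have e2 : ε ^ 3 * ((A.card : ℝ) * B.card) ≤ |∑ x ∈ X, ∑ y ∈ Y, f x y| := by
    rw [e1, abs_mul, abs_of_pos (by positivity), abs_sub_comm]
    calc ε ^ 3 * ((A.card : ℝ) * B.card) = (ε * A.card) * (ε * B.card) * ε := by ring
      _ ≤ _ := by gcongr
  have e3 : (ε ^ 3 * ((A.card : ℝ) * B.card)) ^ 4 ≤ (∑ x ∈ X, ∑ y ∈ Y, f x y) ^ 4 := by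
    rw [← Even.pow_abs (by decide : Even 4) (∑ x ∈ X, ∑ y ∈ Y, f x y)]
    exact pow_le_pow_left₀ (by positivity) e2 4
  have e4 := e3.trans (c4 A B X Y hX hY f)
  by_contra hcon
  push Not at hcon
  set G : α → α → ℝ := fun x' y' => ∑ x ∈ A, ∑ y ∈ B, f x y * (f x' y * f x y') with hG
  have hcon' : ∀ x' y', |G x' y'| < ε ^ 12 * ((A.card : ℝ) * B.card) := by
    intro x' y'
    have := hcon (x', y')
    rw [Finset.sum_product] at this
    exact this
  have e5 : ∑ x' ∈ A, ∑ y' ∈ B, f x' y' * G x' y' <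
      ∑ x' ∈ A, ∑ y' ∈ B, ε ^ 12 * ((A.card : ℝ) * B.card) := by
    apply Finset.sum_lt_sum_of_nonempty hA
    intro x' _
    apply Finset.sum_lt_sum_of_nonempty hB
    intro y' _
    calc f x' y' * G x' y' ≤ |f x' y' * G x' y'| := le_abs_self _
      _ = |f x' y'| * |G x' y'| := abs_mul _ _
      _ ≤ 1 * |G x' y'| := mul_le_mul_of_nonneg_right (ind_sub_abs A B x' y') (abs_nonneg _)
      _ < _ := by rw [one_mul]; exact hcon' _ _
  simp only [Finset.sum_const, nsmul_eq_mul] at e5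
  have e6 := mul_lt_mul_of_pos_left e5 (show (0:ℝ) < (A.card : ℝ) ^ 2 * (B.card : ℝ) ^ 2 by positivity)
  have e7 := lt_of_le_of_lt e4 e6
  apply lt_irrefl _ (lt_of_lt_of_eq e7 _)
  ring

set_option maxHeartbeats 2000000 in
lemma increment {α γ γ' : Type} [Fintype α] [PartialOrder α] (ε : ℝ) (hε : 0 < ε)
    (p : α → γ) (p' : α → γ') (hr : ∀ x y, p' x = p' y → p x = p y)
    (W : γ → γ → α × α)
    (hW : ∀ z ∈ irr ε p, ε ^ 12 * (((cls p z.1).card : ℝ) * (cls p z.2).card) ≤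
      |∑ y ∈ cls p z.1 ×ˢ cls p z.2, (ind y.1 y.2 - dp p z) *
        ((ind (W (p z.1) (p z.2)).1 y.2 - dp p z) * (ind y.1 (W (p z.1) (p z.2)).2 - dp p z))|)
    (h1 : ∀ z : α × α, ∀ x y, p' x = p' y →
      ind (W (p z.1) (p z.2)).1 x = ind (W (p z.1) (p z.2)).1 y)
    (h2 : ∀ z : α × α, ∀ x y, p' x = p' y →
      ind x (W (p z.1) (p z.2)).2 = ind y (W (p z.1) (p z.2)).2) :
    energy p + ε ^ 24 * (irr ε p).card ≤ energy p' := by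
  set h : α × α → ℝ := fun z => (ind (W (p z.1) (p z.2)).1 z.2 - dp p z) *
    (ind z.1 (W (p z.1) (p z.2)).2 - dp p z) with hh
  set S : α × α → ℝ := fun z => ∑ y ∈ cls p z.1 ×ˢ cls p z.2, (ind y.1 y.2 - dp p y) * h y with hS
  have Scongr : ∀ z w : α × α, p z.1 = p w.1 → p z.2 = p w.2 → S z = S w := by
    intro z w e1 e2
    simp only [hS, cls_congr p e1, cls_congr p e2]
  have hSW : ∀ z ∈ irr ε p, ε ^ 12 * (((cls p z.1).card : ℝ) * (cls p z.2).card) ≤ |S z| := by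
    intro z hz
    refine (hW z hz).trans (le_of_eq ?_)
    congr 1
    apply Finset.sum_congr rfl
    intro y hy
    rw [Finset.mem_product, mem_cls, mem_cls] at hy
    simp only [hh]
    rw [hy.1, hy.2, dp_congr p hy.1 hy.2]
  have irrcongr : ∀ z w : α × α, p z.1 = p w.1 → p z.2 = p w.2 → (z ∈ irr ε p ↔ w ∈ irr ε p) := by
    intro z w e1 e2
    simp only [irr, Finset.mem_filter, Finset.mem_univ, true_and, cls_congr p e1, cls_congr p e2]
  set s : α × α → ℝ := fun z => if z ∈ irr ε p then (if 0 ≤ S z then 1 else -1) else 0 with hs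
  have scongr : ∀ z w : α × α, p z.1 = p w.1 → p z.2 = p w.2 → s z = s w := by
    intro z w e1 e2
    simp only [hs, irrcongr z w e1 e2, Scongr z w e1 e2]
  have sabs : ∀ z, |s z| = if z ∈ irr ε p then 1 else 0 := by
    intro z
    simp only [hs]
    split_ifs <;> simp
  have sS : ∀ z, s z * S z = if z ∈ irr ε p then |S z| else 0 := by
    intro z
    simp only [hs]
    split_ifs with a b
    · rw [abs_of_nonneg b]; ring
    · rw [abs_of_neg (not_le.1 b)]; ring
    · ring
  have habs : ∀ z, |h z| ≤ 1 := by
    intro z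
    simp only [hh]
    rw [abs_mul]
    exact mul_le_one₀ (ind_sub_abs _ _ _ _) (abs_nonneg _) (ind_sub_abs _ _ _ _)
  -- lower bound
  have L : ε ^ 12 * (irr ε p).card ≤ ∑ z, (ind z.1 z.2 - dp p z) * (s z * h z) := by
    rw [avg p]
    have : ε ^ 12 * ((irr ε p).card : ℝ) = ∑ z, if z ∈ irr ε p then ε ^ 12 else 0 := by
      rw [← Finset.sum_filter]; simp [mul_comm]
    rw [this]
    apply Finset.sum_le_sum
    intro z _
    have e : ∑ w ∈ cls p z.1 ×ˢ cls p z.2, (ind w.1 w.2 - dp p w) * (s w * h w) = s z * S z := by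
      simp only [hS]
      rw [Finset.mul_sum]
      apply Finset.sum_congr rfl
      intro w hw
      rw [Finset.mem_product, mem_cls, mem_cls] at hw
      rw [scongr w z hw.1 hw.2]; ring
    rw [e, sS]
    have c1 := cls_pos p z.1
    have c2 := cls_pos p z.2
    split_ifs with a
    · rw [le_div_iff₀ (by positivity)]
      exact hSW z a
    · simp
  have P : ∑ z, (ind z.1 z.2 - dp p z) * (s z * h z) = ∑ z, (dp p' z - dp p z) * (s z * h z) := by
    have := proj p' (fun z => s z * h z) (by
      intro z w e1 e2
      have e3 := hr _ _ e1
      have e4 := hr _ _ e2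
      simp only [hh]
      rw [scongr z w e3 e4, dp_congr p e3 e4, h1 z _ _ e2, h2 z _ _ e1, e3, e4])
    simp only [sub_mul, Finset.sum_sub_distrib]
    rw [this]
  have U : ∑ z, (dp p' z - dp p z) * (s z * h z) ≤ ∑ z ∈ irr ε p, |dp p' z - dp p z| := by
    have : ∑ z ∈ irr ε p, |dp p' z - dp p z| = ∑ z, if z ∈ irr ε p then |dp p' z - dp p z| else 0 := by
      rw [← Finset.sum_filter]; simp
    rw [this]
    apply Finset.sum_le_sum
    intro z _
    refine (le_abs_self _).trans ?_
    rw [abs_mul, abs_mul, sabs]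
    split_ifs
    · rw [one_mul]; exact mul_le_of_le_one_right (abs_nonneg _) (habs z)
    · simp
  have C : (∑ z ∈ irr ε p, |dp p' z - dp p z|) ^ 2 ≤
      (irr ε p).card * ∑ z, (dp p' z - dp p z) ^ 2 := by
    refine sq_sum_le_card_mul_sum_sq.trans ?_
    apply mul_le_mul_of_nonneg_left _ (by positivity)
    simp only [sq_abs]
    exact Finset.sum_le_sum_of_subset_of_nonneg (Finset.subset_univ _) fun _ _ _ => sq_nonneg _
  have D := energy_sub p p' hr
  have F : (ε ^ 12 * ((irr ε p).card : ℝ)) ^ 2 ≤ (irr ε p).card * ∑ z, (dp p' z - dp p z) ^ 2 :=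
    (pow_le_pow_left₀ (by positivity) (by linarith) 2).trans C
  rw [← D] at F
  rcases Nat.eq_zero_or_pos (irr ε p).card with h0 | h0
  · have : 0 ≤ energy p' - energy p := by rw [D]; positivity
    rw [h0]; simp; linarith
  · have h0' : (0:ℝ) < (irr ε p).card := by exact_mod_cast h0
    have : ε ^ 24 * ((irr ε p).card : ℝ) ≤ energy p' - energy p := by
      apply le_of_mul_le_mul_left _ h0'
      calc _ = (ε ^ 12 * ((irr ε p).card : ℝ)) ^ 2 := by ring
        _ ≤ _ := F
    linarith

/-- signature -/
noncomputable def sig {α β : Type} [PartialOrder α] (c : α → β) (T : Finset α) (x : α) :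
    β × Finset α × (Finset α)ᵒᵈ :=
  (c x, T.filter (· < x), OrderDual.toDual (T.filter (x < ·)))

lemma sig_mono {α β : Type} [PartialOrder α] [PartialOrder β] (c : α → β) (hc : Monotone c)
    (T : Finset α) : Monotone (sig c T) := by
  intro x y hxy
  refine ⟨hc hxy, ?_, ?_⟩
  · intro t ht
    simp only [sig, Finset.mem_filter] at ht ⊢
    exact ⟨ht.1, ht.2.trans_le hxy⟩
  · change T.filter (y < ·) ⊆ T.filter (x < ·)
    intro t ht
    simp only [Finset.mem_filter] at ht ⊢
    exact ⟨ht.1, hxy.trans_lt ht.2⟩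

lemma sig_iff {α β : Type} [PartialOrder α] (c : α → β) (T : Finset α) (x y : α) :
    sig c T x = sig c T y ↔ c x = c y ∧ (∀ t ∈ T, t < x ↔ t < y) ∧ (∀ t ∈ T, x < t ↔ y < t) := by
  simp only [sig, Prod.mk.injEq, OrderDual.toDual_inj, Finset.ext_iff, Finset.mem_filter,
    and_congr_right_iff]

lemma sig_card {α β : Type} [Fintype α] [PartialOrder α] (c : α → β) (T : Finset α) :
    nimg (sig c T) ≤ nimg c * 4 ^ T.card := by
  unfold nimg
  have : Finset.univ.image (sig c T) ⊆ (Finset.univ.image c) ×ˢ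
      (T.powerset ×ˢ (T.powerset.map (OrderDual.toDual.toEmbedding))) := by
    intro z hz
    rw [Finset.mem_image] at hz
    obtain ⟨x, _, rfl⟩ := hz
    simp [sig]
  have hle := Finset.card_le_card this
  refine le_trans (le_of_eq (by congr!)) (hle.trans (le_of_eq ?_))
  rw [Finset.card_product, Finset.card_product, Finset.card_map, Finset.card_powerset,
    ← mul_pow]
  norm_num

lemma step {α β : Type} [Fintype α] [PartialOrder α] (ε : ℝ) (hε : 0 < ε) (c : α → β)
    (T : Finset α) : ∃ T' : Finset α,
    T'.card ≤ T.card + 2 * nimg (sig c T) ^ 2 ∧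
    energy (sig c T) + ε ^ 24 * (irr ε (sig c T)).card ≤ energy (sig c T') := by
  rcases isEmpty_or_nonempty α with hα | hα
  · refine ⟨T, by omega, ?_⟩
    have : irr ε (sig c T) = ∅ := Finset.eq_empty_of_isEmpty _
    simp [this]
  set p := sig c T with hp
  have key : ∀ a b, ∃ w : α × α, ∀ z ∈ irr ε p, p z.1 = a → p z.2 = b →
      ε ^ 12 * (((cls p z.1).card : ℝ) * (cls p z.2).card) ≤
      |∑ y ∈ cls p z.1 ×ˢ cls p z.2, (ind y.1 y.2 - dp p z) *
        ((ind w.1 y.2 - dp p z) * (ind y.1 w.2 - dp p z))| := by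
    intro a b
    by_cases hz : ∃ z ∈ irr ε p, p z.1 = a ∧ p z.2 = b
    · obtain ⟨z, hz, ha, hb⟩ := hz
      obtain ⟨w, hw⟩ := witness ε hε (cls p z.1) (cls p z.2) ⟨_, self_cls p _⟩ ⟨_, self_cls p _⟩
        (by simpa [irr] using hz)
      refine ⟨w, ?_⟩
      intro z' _ ha' hb'
      have e1 : p z'.1 = p z.1 := ha'.trans ha.symm
      have e2 : p z'.2 = p z.2 := hb'.trans hb.symm
      rw [cls_congr p e1, cls_congr p e2, dp_congr p e1 e2]
      exact hw
    · push Not at hz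
      exact ⟨Classical.arbitrary _, fun z h1 h2 h3 => absurd h3 (hz z h1 h2)⟩
  choose W hW using key
  set I := Finset.univ.image p with hI
  have hIc : nimg p = I.card := by
    rw [hI, nimg]; congr!
  set T' := T ∪ ((I ×ˢ I).image (fun z => (W z.1 z.2).1) ∪ (I ×ˢ I).image (fun z => (W z.1 z.2).2))
    with hT'
  have hm : ∀ z : α × α, (W (p z.1) (p z.2)).1 ∈ T' ∧ (W (p z.1) (p z.2)).2 ∈ T' := by
    intro z
    have : (p z.1, p z.2) ∈ I ×ˢ I := by simp [hI]
    constructor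
    · exact Finset.mem_union_right _ (Finset.mem_union_left _
        (Finset.mem_image_of_mem (fun z => (W z.1 z.2).1) this))
    · exact Finset.mem_union_right _ (Finset.mem_union_right _
        (Finset.mem_image_of_mem (fun z => (W z.1 z.2).2) this))
  refine ⟨T', ?_, ?_⟩
  · refine (Finset.card_union_le _ _).trans ?_
    have h1 : ((I ×ˢ I).image (fun z => (W z.1 z.2).1)).card ≤ I.card ^ 2 :=
      Finset.card_image_le.trans (by rw [Finset.card_product, sq])
    have h2 : ((I ×ˢ I).image (fun z => (W z.1 z.2).2)).card ≤ I.card ^ 2 :=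
      Finset.card_image_le.trans (by rw [Finset.card_product, sq])
    have h3 := Finset.card_union_le ((I ×ˢ I).image (fun z => (W z.1 z.2).1))
      ((I ×ˢ I).image (fun z => (W z.1 z.2).2))
    rw [hIc]
    omega
  · apply increment ε hε p (sig c T') _ W (fun z hz => hW _ _ z hz rfl rfl)
    · intro z x y hxy
      rw [sig_iff] at hxy
      simp only [ind, hxy.2.1 _ (hm z).1]
    · intro z x y hxy
      rw [sig_iff] at hxy
      simp only [ind, hxy.2.2 _ (hm z).2]
    · intro x y hxy
      rw [hp, sig_iff]
      rw [sig_iff] at hxy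
      exact ⟨hxy.1, fun t ht => hxy.2.1 t (Finset.mem_union_left _ ht),
        fun t ht => hxy.2.2 t (Finset.mem_union_left _ ht)⟩

def bnd (K : ℕ) : ℕ → ℕ
  | 0 => 0
  | s + 1 => bnd K s + 2 * (K * 4 ^ bnd K s) ^ 2

lemma iter {α β : Type} [Fintype α] [PartialOrder α] (ε : ℝ) (hε : 0 < ε) (c : α → β)
    (K : ℕ) (hK : nimg c ≤ K) (s : ℕ) : ∃ T : Finset α,
    T.card ≤ bnd K s ∧ (((irr ε (sig c T)).card : ℝ) ≤ ε / 4 * (Fintype.card α : ℝ) ^ 2 ∨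
      s * (ε ^ 24 * (ε / 4 * (Fintype.card α : ℝ) ^ 2)) ≤ energy (sig c T)) := by
  induction s with
  | zero =>
    refine ⟨∅, by simp, Or.inr ?_⟩
    simp only [CharP.cast_eq_zero, zero_mul]
    exact Finset.sum_nonneg fun _ _ => sq_nonneg _
  | succ s ih =>
    obtain ⟨T, hT, h⟩ := ih
    by_cases h' : ((irr ε (sig c T)).card : ℝ) ≤ ε / 4 * (Fintype.card α : ℝ) ^ 2
    · exact ⟨T, by rw [bnd]; omega, Or.inl h'⟩
    · have h := h.resolve_left h'
      obtain ⟨T', h1, h2⟩ := step ε hε c T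
      refine ⟨T', ?_, Or.inr ?_⟩
      · refine h1.trans ?_
        rw [bnd]
        have : nimg (sig c T) ≤ K * 4 ^ bnd K s :=
          (sig_card c T).trans (Nat.mul_le_mul hK (Nat.pow_le_pow_right (by norm_num) hT))
        have := Nat.pow_le_pow_left this 2
        omega
      · push Not at h'
        have := mul_le_mul_of_nonneg_left h'.le (show 0 ≤ ε ^ 24 by positivity)
        push_cast
        linarith

lemma exists_T (ε : ℝ) (hε : 0 < ε) (K : ℕ) : ∃ M : ℕ, ∀ (α β : Type) [Fintype α] [PartialOrder α]
    (c : α → β), nimg c ≤ K → ∃ T : Finset α,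
    nimg (sig c T) ≤ M ∧
    ((irr ε (sig c T)).card : ℝ) ≤ ε / 4 * (Fintype.card α : ℝ) ^ 2 := by
  obtain ⟨s, hs⟩ := exists_nat_gt (1 / (ε ^ 24 * (ε / 4)))
  refine ⟨K * 4 ^ bnd K s, ?_⟩
  intro α β _ _ c hK
  obtain ⟨T, h1, h2⟩ := iter ε hε c K hK s
  refine ⟨T, (sig_card c T).trans (Nat.mul_le_mul hK (Nat.pow_le_pow_right (by norm_num) h1)), ?_⟩
  rcases h2 with h2 | h2
  · exact h2
  · rcases isEmpty_or_nonempty α with hα | hα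
    · have : irr ε (sig c T) = ∅ := Finset.eq_empty_of_isEmpty _
      simp [this]
    · exfalso
      have h3 := h2.trans (energy_le _)
      have hn : (0:ℝ) < Fintype.card α := by exact_mod_cast Fintype.card_pos
      rw [div_lt_iff₀ (by positivity)] at hs
      have := mul_lt_mul_of_pos_right hs (show (0:ℝ) < (Fintype.card α : ℝ) ^ 2 by positivity)
      nlinarith

/-- from a monotone colouring to an ordered partition -/
lemma toPart {α γ : Type} [Fintype α] [PartialOrder α] [PartialOrder γ] (p : α → γ)
    (hp : Monotone p) : ∃ V : Fin (nimg p) → Finset α, IsPosetPartition V ∧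
      ∀ i, ∃ x, V i = cls p x := by
  let e : α → LinearExtension γ := fun x => toLinearExtension (p x)
  have he : Monotone e := fun x y h => toLinearExtension.monotone (hp h)
  have hinj : ∀ x y, e x = e y ↔ p x = p y := fun x y => Iff.rfl
  have hcard : (Finset.univ.image e).card = nimg p := by
    have : Finset.univ.image e = (Finset.univ.image p).image
        (fun g => (toLinearExtension g : LinearExtension γ)) := by
      ext; simp [e]
    rw [this, Finset.card_image_of_injective, nimg]
    exact fun _ _ h => h
  let f := (Finset.univ.image e).orderIsoOfFin hcard
  refine ⟨fun i => Finset.univ.filter fun x => e x = f i, ⟨?_, ?_, ?_⟩, ?_⟩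
  · intro i j hij
    rw [Finset.disjoint_left]
    intro x hx hy
    simp only [Finset.mem_filter, Finset.mem_univ, true_and] at hx hy
    exact hij (f.injective (Subtype.ext (hx.symm.trans hy)))
  · ext x
    simp only [Finset.mem_biUnion, Finset.mem_filter, Finset.mem_univ, true_and, iff_true]
    refine ⟨f.symm ⟨e x, Finset.mem_image_of_mem _ (Finset.mem_univ _)⟩, ?_⟩
    simp
  · intro i j hji x hx y hy hxy
    simp only [Finset.mem_filter, Finset.mem_univ, true_and] at hx hy
    have h1 := he hxy.le
    rw [hx, hy] at h1
    have h2 : f i ≤ f j := h1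
    rw [f.le_iff_le] at h2
    exact absurd hji (not_lt.2 h2)
  · intro i
    obtain ⟨x, _, hx⟩ := Finset.mem_image.1 (f i).2
    refine ⟨x, ?_⟩
    ext y
    simp only [Finset.mem_filter, Finset.mem_univ, true_and, mem_cls, ← hinj, hx]

lemma initial (ε : ℝ) (hε : 0 < ε) : ∃ K : ℕ, ∀ (α : Type) [Fintype α] [PartialOrder α]
      (k : ℕ) (V₀ : Fin k → Finset α), (k : ℝ) ≤ 1 / ε → IsPosetPartition V₀ →
      ∃ c : α → Fin k × ℕ, Monotone c ∧ nimg c ≤ K ∧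
        (∀ x, x ∈ V₀ (c x).1) ∧
        ∀ x, ((cls c x).card : ℝ) ≤ max (ε * (Fintype.card α : ℝ)) 1 := by
  obtain ⟨N, hN⟩ := exists_nat_ge (1 / ε)
  refine ⟨N * (2 * N + 1), ?_⟩
  intro α _ _ k V₀ hk hV
  obtain ⟨hd, hc, ho⟩ := hV
  have hex : ∀ x, ∃ i, x ∈ V₀ i := by
    intro x
    have : x ∈ Finset.univ.biUnion V₀ := by rw [hc]; exact Finset.mem_univ x
    simpa using this
  choose a ha using hex
  have amono : Monotone a := by
    intro x y hxy
    rcases hxy.eq_or_lt with rfl | hlt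
    · exact le_rfl
    · by_contra hcon
      exact ho _ _ (not_le.1 hcon) x (ha x) y (ha y) hlt
  let n := Fintype.card α
  let s : ℕ := max 1 ⌊ε * n⌋₊
  have hs : 0 < s := by simp [s]
  let f : Fin n ≃o LinearExtension α :=
    @Fintype.orderIsoFinOfCardEq (LinearExtension α) _ ‹Fintype α› n rfl
  let r : α → Fin n := fun x => f.symm (toLinearExtension x)
  have rmono : Monotone r := fun x y h => f.symm.monotone (toLinearExtension.monotone h)
  have rinj : Function.Injective r := fun x y h => f.symm.injective h
  let c : α → Fin k × ℕ := fun x => (a x, (r x : ℕ) / s)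
  refine ⟨c, ?_, ?_, ha, ?_⟩
  · intro x y h
    exact ⟨amono h, Nat.div_le_div_right (rmono h)⟩
  · have hkN : k ≤ N := by exact_mod_cast hk.trans hN
    have hns : n ≤ 2 * N * s := by
      have hεN : 1 ≤ ε * N := by
        rw [div_le_iff₀ hε] at hN; linarith
      have : (n:ℝ) ≤ 2 * N * s := by
        have h1 : ε * n < ⌊ε * n⌋₊ + 1 := Nat.lt_floor_add_one _
        have h2 : (⌊ε * n⌋₊ : ℝ) ≤ s := by exact_mod_cast le_max_right _ _
        have h3 : (1:ℝ) ≤ s := by exact_mod_cast hs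
        have h4 : ε * n ≤ 2 * s := by linarith
        have h5 : (n:ℝ) ≤ ε * N * n := le_mul_of_one_le_left (by positivity) hεN
        have h6 : (N:ℝ) * (ε * n) ≤ N * (2 * s) := mul_le_mul_of_nonneg_left h4 (by positivity)
        linarith
      exact_mod_cast this
    have hsub : Finset.univ.image c ⊆ (Finset.univ : Finset (Fin k)) ×ˢ Finset.range (2 * N + 1) := by
      intro z hz
      obtain ⟨x, _, rfl⟩ := Finset.mem_image.1 hz
      simp only [c, Finset.mem_product, Finset.mem_univ, true_and, Finset.mem_range]
      have : (r x : ℕ) / s ≤ 2 * N := by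
        apply Nat.div_le_of_le_mul
        have := (r x).2
        rw [mul_comm]; omega
      omega
    have hle : nimg c ≤ ((Finset.univ : Finset (Fin k)) ×ˢ Finset.range (2 * N + 1)).card := by
      unfold nimg
      convert Finset.card_le_card hsub
    refine hle.trans ?_
    rw [Finset.card_product, Finset.card_univ, Fintype.card_fin, Finset.card_range]
    exact Nat.mul_le_mul_right _ hkN
  · intro x
    have h1 : (cls c x).card ≤ s := by
      have : (cls c x).card ≤ (Finset.Ico (s * ((r x : ℕ) / s)) (s * ((r x : ℕ) / s) + s)).card := by
        apply Finset.card_le_card_of_injOn (fun y => (r y : ℕ))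
        · intro y hy
          have hy : c y = c x := (mem_cls c x y).1 hy
          have h2 : (r y : ℕ) / s = (r x : ℕ) / s := congrArg Prod.snd hy
          simp only [Finset.coe_Ico, Set.mem_Ico]
          rw [← h2]
          exact ⟨Nat.mul_div_le _ _, Nat.lt_mul_div_succ _ hs⟩
        · intro y _ y' _ h
          exact rinj (Fin.ext h)
      simpa using this
    have h2 : (s : ℝ) ≤ max (ε * (n : ℝ)) 1 := by
      simp only [s, Nat.cast_max, Nat.cast_one]
      apply max_le (le_max_right _ _)
      exact (Nat.floor_le (by positivity)).trans (le_max_left _ _)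
    exact le_trans (by exact_mod_cast h1) h2

end PR

/-- Regularity lemma for posets. -/
theorem stmt12 (ε : ℝ) (hε : 0 < ε) :
    ∃ M : ℕ, ∀ (α : Type) [Fintype α] [PartialOrder α],
      ∀ (k : ℕ) (V₀ : Fin k → Finset α), (k : ℝ) ≤ 1 / ε → IsPosetPartition V₀ →
        ∃ (m : ℕ) (ℛ : Fin m → Finset α), m ≤ M ∧
          IsPosetPartition ℛ ∧
          (∀ i : Fin m, ∃ j : Fin k, ℛ i ⊆ V₀ j) ∧
          IsRegularPartition ε ℛ := by
  obtain ⟨K, hK⟩ := PR.initial ε hε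
  obtain ⟨M, hM⟩ := PR.exists_T ε hε K
  refine ⟨M, ?_⟩
  intro α _ _ k V₀ hk hV
  obtain ⟨c, c1, c2, c3, c4⟩ := hK α k V₀ hk hV
  obtain ⟨T, t1, t2⟩ := hM α (Fin k × ℕ) c c2
  obtain ⟨V, v1, v2⟩ := PR.toPart (PR.sig c T) (PR.sig_mono c c1 T)
  have hsub : ∀ x, PR.cls (PR.sig c T) x ⊆ PR.cls c x := by
    intro x y hy
    rw [PR.mem_cls] at hy ⊢
    exact ((PR.sig_iff c T y x).1 hy).1
  refine ⟨_, V, t1, v1, ?_, ?_, ?_⟩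
  · intro i
    obtain ⟨x, hx⟩ := v2 i
    refine ⟨(c x).1, ?_⟩
    rw [hx]
    intro y hy
    have := (PR.mem_cls c x y).1 (hsub x hy)
    rw [← this]
    exact c3 y
  · intro i
    obtain ⟨x, hx⟩ := v2 i
    rw [hx]
    refine le_trans ?_ (c4 x)
    exact_mod_cast Finset.card_le_card (hsub x)
  · by_cases hn : Fintype.card α ≤ 1
    · have : Subsingleton α := Fintype.card_le_one_iff_subsingleton.1 hn
      rw [Finset.sum_eq_zero]
      · positivity
      · intro z hz
        simp only [Finset.mem_filter, Finset.mem_univ, true_and] at hz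
        rcases (V z.1).eq_empty_or_nonempty with h | ⟨x, hx⟩
        · simp [h]
        · rcases (V z.2).eq_empty_or_nonempty with h | ⟨y, hy⟩
          · simp [h]
          · rw [Subsingleton.elim y x] at hy
            exact absurd hy (Finset.disjoint_left.1 (v1.1 _ _ hz.1.ne) hx)
    · push Not at hn
      set F := Finset.univ.filter
        (fun p : Fin _ × Fin _ => p.1 < p.2 ∧ ¬ IsRegularPair ε (V p.1) (V p.2)) with hF
      have h1 : ∑ p ∈ F, (V p.1).card * (V p.2).card ≤ (PR.irr ε (PR.sig c T)).card := by
        have e : ∑ p ∈ F, (V p.1).card * (V p.2).card =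
            (F.biUnion fun p => V p.1 ×ˢ V p.2).card := by
          rw [Finset.card_biUnion]
          · simp [Finset.card_product]
          · intro p _ q _ hpq
            refine Finset.disjoint_left.2 ?_
            intro z hz hz'
            rw [Finset.mem_product] at hz hz'
            apply hpq
            apply Prod.ext
            · by_contra hne
              exact Finset.disjoint_left.1 (v1.1 _ _ hne) hz.1 hz'.1
            · by_contra hne
              exact Finset.disjoint_left.1 (v1.1 _ _ hne) hz.2 hz'.2
        rw [e]
        apply Finset.card_le_card
        intro z hz
        rw [Finset.mem_biUnion] at hz
        obtain ⟨p, hp, hz⟩ := hz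
        rw [Finset.mem_product] at hz
        simp only [hF, Finset.mem_filter, Finset.mem_univ, true_and] at hp
        obtain ⟨x, hx⟩ := v2 p.1
        obtain ⟨y, hy⟩ := v2 p.2
        rw [hx, hy, PR.mem_cls, PR.mem_cls] at hz
        simp only [PR.irr, Finset.mem_filter, Finset.mem_univ, true_and]
        rw [PR.cls_congr _ hz.1, PR.cls_congr _ hz.2, ← hx, ← hy]
        exact hp.2
      have h2 : ∑ p ∈ F, ((V p.1).card : ℝ) * ((V p.2).card : ℝ) ≤
          ((PR.irr ε (PR.sig c T)).card : ℝ) := by exact_mod_cast h1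
      refine (h2.trans t2).trans ?_
      rw [Nat.cast_choose_two]
      have h3 : (2:ℝ) ≤ Fintype.card α := by exact_mod_cast hn
      have h4 : (Fintype.card α : ℝ) ^ 2 / 4 ≤
          (Fintype.card α : ℝ) * ((Fintype.card α : ℝ) - 1) / 2 := by nlinarith
      have := mul_le_mul_of_nonneg_left h4 hε.le
      linarith
end
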